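/- Let m ≥ 1 be an integer, t₀ ∈ ℝ, u : Fin m → (ℝ → ℝ), and u₀ : ℝ → ℝ. Define A(t) := Σ_j u_j(t) and B(t) := Σ_j u_j(t)². Suppose that for every index j and every t ∈ ℝ, u_j has derivative (u₀(t) − A(t))·u_j(t) at t, that for every t ∈ ℝ, u₀ has derivative B(t) + (u₀(t) − A(t))·A(t) at t, and that u_j(t₀) ≠ 0 for some index j. Then a contradiction follows; that is, the steady system (4.4) admits no solution defined on all of ℝ with some u_j not identically vanishing. -/

import Mathlib

/-- A function with `y' ≥ y²` on `[a, ∞)` and `y a > 0` blows up in finite time. -/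
theorem false_of_sq_le_hasDerivAt {y y' : ℝ → ℝ} {a : ℝ} (ha : 0 < y a)
    (hy : ∀ t, a ≤ t → HasDerivAt y (y' t) t) (h : ∀ t, a ≤ t → y t ^ 2 ≤ y' t) : False := by
  have hmono : MonotoneOn y (Set.Ici a) := by
    refine monotoneOn_of_hasDerivWithinAt_nonneg (f' := y') (convex_Ici a)
      (fun t ht => (hy t ht).continuousAt.continuousWithinAt) (fun t ht => ?_) (fun t ht => ?_)
    · exact (hy t (interior_subset ht)).hasDerivWithinAt
    · exact (sq_nonneg _).trans (h t (interior_subset ht))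
  have hpos : ∀ t, a ≤ t → 0 < y t := fun t ht =>
    ha.trans_le (hmono Set.self_mem_Ici ht ht)
  have hd : ∀ t, a ≤ t → HasDerivAt (fun s => (y s)⁻¹ + s) (-y' t / y t ^ 2 + 1) t :=
    fun t ht => ((hy t ht).fun_inv (hpos t ht).ne').add (hasDerivAt_id t)
  have hanti : AntitoneOn (fun s => (y s)⁻¹ + s) (Set.Ici a) := by
    refine antitoneOn_of_hasDerivWithinAt_nonpos (convex_Ici a)
      (fun t ht => (hd t ht).continuousAt.continuousWithinAt)
      (fun t ht => (hd t (interior_subset ht)).hasDerivWithinAt) (fun t ht => ?_)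
    have ht' : a ≤ t := interior_subset ht
    have : 1 ≤ y' t / y t ^ 2 := (one_le_div (pow_pos (hpos t ht') 2)).2 (h t ht')
    rw [neg_div]
    linarith
  have hinv : 0 < (y a)⁻¹ := inv_pos.2 ha
  have hle : a ≤ a + (y a)⁻¹ := by linarith
  have key := hanti Set.self_mem_Ici hle hle
  have := inv_pos.2 (hpos _ hle)
  linarith

/-- A positive value of a solution of positive derivative of the Riccati equation
`w' = w² + c` forces blow-up in finite time. -/
theorem false_of_riccati_of_pos {w : ℝ → ℝ} {c a : ℝ}
    (hw : ∀ t, HasDerivAt w (w t ^ 2 + c) t) (hpos : ∀ t, 0 < w t ^ 2 + c) (ha : 0 < w a) :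
    False := by
  have hmono : StrictMono w := strictMono_of_hasDerivAt_pos hw hpos
  have hk : √(-c) < w a := (Real.sqrt_lt' ha).2 (by linarith [hpos a])
  refine false_of_sq_le_hasDerivAt (y := fun t => w t - √(-c)) (a := a) (sub_pos.2 hk)
    (fun t _ => (hw t).sub_const _) (fun t ht => ?_)
  have hwt : √(-c) < w t := hk.trans_le (hmono.monotone ht)
  have h0 : 0 ≤ √(-c) := Real.sqrt_nonneg _
  rcases le_total 0 c with hc | hc
  · rw [Real.sqrt_eq_zero_of_nonpos (by linarith)]
    linarith
  · nlinarith [Real.sq_sqrt (neg_nonneg.2 hc)]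

/-- The Riccati equation `w' = w² + c` has no global solution of positive derivative. -/
theorem false_of_riccati {w : ℝ → ℝ} {c : ℝ}
    (hw : ∀ t, HasDerivAt w (w t ^ 2 + c) t) (hpos : ∀ t, 0 < w t ^ 2 + c) : False := by
  have hmono : StrictMono w := strictMono_of_hasDerivAt_pos hw hpos
  have hnonpos : ∀ t, w t ≤ 0 := fun t => not_lt.1 (false_of_riccati_of_pos hw hpos)
  have hneg : w 0 < 0 := (hmono one_pos).trans_le (hnonpos 1)
  refine false_of_riccati_of_pos (w := fun t => -w (-t)) (c := c) (a := 0) (fun t => ?_)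
    (fun t => by simpa using hpos (-t)) (by simpa using hneg)
  exact ((hw (-t)).comp t (hasDerivAt_neg t)).neg.congr_deriv (by ring)

/-- A solution of a scalar linear equation `v' = w v` vanishes either nowhere or everywhere. -/
theorem ne_zero_of_hasDerivAt_mul {v w : ℝ → ℝ} (hw : Continuous w)
    (hv : ∀ t, HasDerivAt v (w t * v t) t) {a : ℝ} (ha : v a ≠ 0) (t : ℝ) : v t ≠ 0 := by
  have hW : ∀ t, HasDerivAt (fun s => ∫ x in a..s, w x) (w t) t := fun t =>
    intervalIntegral.integral_hasDerivAt_right (hw.intervalIntegrable _ _)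
      hw.aestronglyMeasurable.stronglyMeasurableAtFilter hw.continuousAt
  have hd : ∀ t, HasDerivAt (fun s => v s * Real.exp (-∫ x in a..s, w x)) 0 t := fun t => by
    refine ((hv t).fun_mul (hW t).fun_neg.exp).congr_deriv ?_
    ring
  have hconst := is_const_of_deriv_eq_zero (fun t => (hd t).differentiableAt)
    (fun t => (hd t).deriv) t a
  intro h0
  simp [h0] at hconst
  exact ha hconst.symm


/-- ODE reformulation of Proposition 4.2: the steady system (4.4)
u_j' = (u₀ − A)u_j, u₀' = B + (u₀ − A)A, with A = Σ_j u_j and B = Σ_j u_j², admits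
no solution defined on all of ℝ with some u_j not identically vanishing. -/
theorem steady_system_no_global_solution (m : ℕ) (hm : 1 ≤ m) (t₀ : ℝ)
    (u : Fin m → ℝ → ℝ) (u₀ : ℝ → ℝ)
    (hu : ∀ (j : Fin m) (t : ℝ),
      HasDerivAt (u j) ((u₀ t - ∑ i, u i t) * u j t) t)
    (hu₀ : ∀ t : ℝ,
      HasDerivAt u₀ ((∑ i, u i t ^ 2) + (u₀ t - ∑ i, u i t) * (∑ i, u i t)) t)
    (hj : ∃ j : Fin m, u j t₀ ≠ 0) :
    False := by
  obtain ⟨j, hj⟩ := hj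
  set w : ℝ → ℝ := fun t => u₀ t - ∑ i, u i t with hwdef
  have hw : ∀ t, HasDerivAt w (∑ i, u i t ^ 2) t := fun t => by
    refine ((hu₀ t).fun_sub
      (HasDerivAt.fun_sum fun i (_ : i ∈ Finset.univ) => hu i t)).congr_deriv ?_
    rw [← Finset.mul_sum]
    ring
  have hcont : Continuous w := continuous_iff_continuousAt.2 fun t => (hw t).continuousAt
  have hB : ∀ t, 0 < ∑ i, u i t ^ 2 := fun t =>
    Finset.sum_pos' (fun i _ => sq_nonneg _)
      ⟨j, Finset.mem_univ j, sq_pos_of_ne_zero (ne_zero_of_hasDerivAt_mul hcont (hu j) hj t)⟩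
  have hd : ∀ t, HasDerivAt (fun s => ∑ i, u i s ^ 2 - w s ^ 2) 0 t := fun t => by
    refine ((HasDerivAt.fun_sum fun i (_ : i ∈ Finset.univ) => (hu i t).fun_pow 2).fun_sub
      ((hw t).fun_pow 2)).congr_deriv ?_
    rw [Finset.mul_sum, ← Finset.sum_sub_distrib]
    refine Finset.sum_eq_zero fun i _ => ?_
    simp only [hwdef]
    push_cast
    ring
  have hc : ∀ t, w t ^ 2 + (∑ i, u i t₀ ^ 2 - w t₀ ^ 2) = ∑ i, u i t ^ 2 := fun t => by
    have := is_const_of_deriv_eq_zero (fun t => (hd t).differentiableAt)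
      (fun t => (hd t).deriv) t t₀
    linarith
  exact false_of_riccati (fun t => by rw [hc t]; exact hw t) (fun t => by rw [hc t]; exact hB t)
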